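/- For every natural number n, the number of large (3,2)-Motzkin paths of length n equals the n-th large Schröder number S_n, i.e., the number of large Schröder paths of length 2n. -/

import Mathlib

/-- Steps of a (3,2)-Motzkin path: one up step, two colored down steps,
three colored level steps. -/
inductive MStep : Type
  | U | D1 | D2 | L1 | L2 | L3
  deriving DecidableEq

/-- Height contribution of a single step. -/
def MStep.height : MStep → ℤ
  | .U  => 1
  | .D1 => -1
  | .D2 => -1
  | .L1 => 0
  | .L2 => 0
  | .L3 => 0

/-- Total height of a list of steps. -/
def mHeight (p : List MStep) : ℤ := (p.map MStep.height).sum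

/-- A (3,2)-Motzkin path: all prefixes have nonnegative height and the
total height is 0. -/
def IsMotzkin32 (p : List MStep) : Prop :=
  (∀ q : List MStep, q <+: p → 0 ≤ mHeight q) ∧ mHeight p = 0

/-- A large (3,2)-Motzkin path: a (3,2)-Motzkin path with no `L3` level step
on the x-axis, i.e. the prefix preceding any `L3` step has positive height. -/
def IsLargeMotzkin32 (p : List MStep) : Prop :=
  IsMotzkin32 p ∧ ∀ a b : List MStep, p = a ++ MStep.L3 :: b → 0 < mHeight a

/-- `m32 n` is the number of (3,2)-Motzkin paths of length `n`. -/
noncomputable def m32 (n : ℕ) : ℕ :=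
  {p : List MStep | p.length = n ∧ IsMotzkin32 p}.ncard

/-- `L32 n` is the number of large (3,2)-Motzkin paths of length `n`. -/
noncomputable def L32 (n : ℕ) : ℕ :=
  {p : List MStep | p.length = n ∧ IsLargeMotzkin32 p}.ncard

/-- An elevated large (3,2)-Motzkin path: a large (3,2)-Motzkin path that
touches the x-axis only at its endpoints. -/
def IsElevatedLargeMotzkin32 (p : List MStep) : Prop :=
  IsLargeMotzkin32 p ∧
    ∀ q : List MStep, q <+: p → q ≠ [] → q ≠ p → 0 < mHeight q

/-- A linked partition of `{1,…,n}`: blocks are nonempty subsets of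
`{1,…,n}` covering it, and any two distinct blocks are nearly disjoint. -/
def IsLinkedPartition (n : ℕ) (π : Finset (Finset ℕ)) : Prop :=
  (∀ B ∈ π, B.Nonempty ∧ B ⊆ Finset.Icc 1 n) ∧
  (∀ i ∈ Finset.Icc 1 n, ∃ B ∈ π, i ∈ B) ∧
  (∀ B ∈ π, ∀ B' ∈ π, B ≠ B' → ∀ k, k ∈ B → k ∈ B' →
    ((∀ j ∈ B, k ≤ j) ∧ 1 < B.card ∧ ¬ (∀ j ∈ B', k ≤ j)) ∨
    ((∀ j ∈ B', k ≤ j) ∧ 1 < B'.card ∧ ¬ (∀ j ∈ B, k ≤ j)))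

/-- Noncrossing condition for a collection of blocks. -/
def IsNoncrossing (π : Finset (Finset ℕ)) : Prop :=
  ¬ ∃ B ∈ π, ∃ B' ∈ π, B ≠ B' ∧
      ∃ i₁ ∈ B, ∃ j₁ ∈ B, ∃ i₂ ∈ B', ∃ j₂ ∈ B',
        i₁ < i₂ ∧ i₂ < j₁ ∧ j₁ < j₂

/-- `ncl n` is the number of noncrossing linked partitions of `{1,…,n}`. -/
noncomputable def ncl (n : ℕ) : ℕ :=
  {π : Finset (Finset ℕ) | IsLinkedPartition n π ∧ IsNoncrossing π}.ncard

/-- Steps of a Schröder path: up, level (width 2), down. -/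
inductive SStep : Type
  | U | L | D
  deriving DecidableEq

/-- Height contribution of a Schröder step. -/
def SStep.height : SStep → ℤ
  | .U => 1
  | .L => 0
  | .D => -1

/-- Width contribution of a Schröder step. -/
def SStep.width : SStep → ℕ
  | .U => 1
  | .L => 2
  | .D => 1

/-- Total height of a list of Schröder steps. -/
def sHeight (p : List SStep) : ℤ := (p.map SStep.height).sum

/-- Total width of a list of Schröder steps. -/
def sWidth (p : List SStep) : ℕ := (p.map SStep.width).sum

/-- A large Schröder path of length `2n`. -/
def IsLargeSchroeder (n : ℕ) (p : List SStep) : Prop :=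
  sWidth p = 2 * n ∧ (∀ q : List SStep, q <+: p → 0 ≤ sHeight q) ∧
    sHeight p = 0

/-- A little Schröder path of length `2n`: a large Schröder path with no
level step on the x-axis. -/
def IsLittleSchroeder (n : ℕ) (p : List SStep) : Prop :=
  IsLargeSchroeder n p ∧ ∀ a b : List SStep, p = a ++ SStep.L :: b → 0 < sHeight a

/-- `SchroederLarge n` is the `n`-th large Schröder number. -/
noncomputable def SchroederLarge (n : ℕ) : ℕ :=
  {p : List SStep | IsLargeSchroeder n p}.ncard

/-- `SchroederLittle n` is the `n`-th little Schröder number. -/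
noncomputable def SchroederLittle (n : ℕ) : ℕ :=
  {p : List SStep | IsLittleSchroeder n p}.ncard

section Helpers

open PowerSeries

/-- A finite set of nonempty lists is counted by first letter. -/
theorem ncard_by_head {σ : Type} [Fintype σ] (A : Set (List σ)) (hA : A.Finite)
    (hnil : [] ∉ A) : A.ncard = ∑ s : σ, {p : List σ | s :: p ∈ A}.ncard := by
  have hfin : ∀ s : σ, Finite {p : List σ | s :: p ∈ A} := fun s =>
    (hA.preimage (f := fun p => s :: p) (fun a _ b _ h => (List.cons.inj h).2)).to_subtype
  have e : (Σ s : σ, {p : List σ | s :: p ∈ A}) ≃ A :=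
    Equiv.ofBijective (fun x => ⟨x.1 :: x.2.1, x.2.2⟩) (by
      constructor
      · rintro ⟨s, p, hp⟩ ⟨t, q, hq⟩ h
        simp only [Subtype.mk.injEq, List.cons.injEq] at h
        obtain ⟨rfl, rfl⟩ := h
        rfl
      · rintro ⟨p, hp⟩
        cases p with
        | nil => exact absurd hp hnil
        | cons s p => exact ⟨⟨s, p, hp⟩, rfl⟩)
  rw [← Nat.card_coe_set_eq, ← Nat.card_congr e, Nat.card_sigma]
  simp only [Nat.card_coe_set_eq]

instance : Fintype MStep where
  elems := {.U, .D1, .D2, .L1, .L2, .L3}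
  complete := by intro x; cases x <;> decide

instance : Fintype SStep where
  elems := {.U, .L, .D}
  complete := by intro x; cases x <;> decide

theorem sum_MStep (f : MStep → ℕ) :
    ∑ s, f s = f .U + f .D1 + f .D2 + f .L1 + f .L2 + f .L3 := by
  have : (Finset.univ : Finset MStep) = {.U, .D1, .D2, .L1, .L2, .L3} := rfl
  rw [this]
  simp [add_assoc]

theorem sum_SStep (f : SStep → ℕ) : ∑ s, f s = f .U + f .L + f .D := by
  have : (Finset.univ : Finset SStep) = {.U, .L, .D} := rfl
  rw [this]
  simp [add_assoc]

/-- Large Motzkin suffixes starting at height `h`. -/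
def MSuf (h : ℤ) (p : List MStep) : Prop :=
  (∀ q : List MStep, q <+: p → 0 ≤ h + mHeight q) ∧ h + mHeight p = 0 ∧
    ∀ a b : List MStep, p = a ++ MStep.L3 :: b → 0 < h + mHeight a

/-- Schröder suffixes starting at height `h`. -/
def SSuf (h : ℤ) (p : List SStep) : Prop :=
  (∀ q : List SStep, q <+: p → 0 ≤ h + sHeight q) ∧ h + sHeight p = 0

theorem mHeight_nil : mHeight [] = 0 := rfl
theorem mHeight_cons (s : MStep) (p : List MStep) :
    mHeight (s :: p) = s.height + mHeight p := by simp [mHeight]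
theorem sHeight_nil : sHeight [] = 0 := rfl
theorem sHeight_cons (s : SStep) (p : List SStep) :
    sHeight (s :: p) = s.height + sHeight p := by simp [sHeight]
theorem sWidth_cons (s : SStep) (p : List SStep) :
    sWidth (s :: p) = s.width + sWidth p := by simp [sWidth]

theorem MSuf_nil (h : ℤ) : MSuf h [] ↔ h = 0 := by
  simp [MSuf, mHeight_nil]
  omega

theorem SSuf_nil (h : ℤ) : SSuf h [] ↔ h = 0 := by
  simp [SSuf, sHeight_nil]
  omega

theorem MSuf_cons (h : ℤ) (s : MStep) (p : List MStep) :
    MSuf h (s :: p) ↔ 0 ≤ h ∧ (s = .L3 → 0 < h) ∧ MSuf (h + s.height) p := by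
  constructor
  · rintro ⟨h1, h2, h3⟩
    refine ⟨by simpa [mHeight_nil] using h1 [] (List.nil_prefix), ?_, ?_, ?_, ?_⟩
    · rintro rfl
      simpa [mHeight_nil] using h3 [] p rfl
    · intro q hq
      have := h1 (s :: q) (by simpa using hq)
      rw [mHeight_cons] at this
      omega
    · rw [mHeight_cons] at h2
      omega
    · rintro a b rfl
      have := h3 (s :: a) b rfl
      rw [mHeight_cons] at this
      omega
  · rintro ⟨h0, hs, h1, h2, h3⟩
    refine ⟨?_, ?_, ?_⟩
    · intro q hq
      rcases List.prefix_cons_iff.1 hq with rfl | ⟨t, rfl, ht⟩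
      · simpa [mHeight_nil] using h0
      · have := h1 t ht
        rw [mHeight_cons]
        omega
    · rw [mHeight_cons]
      omega
    · intro a b hab
      cases a with
      | nil =>
        simp only [List.nil_append, List.cons.injEq] at hab
        simpa [mHeight_nil] using hs hab.1
      | cons t a =>
        simp only [List.cons_append, List.cons.injEq] at hab
        obtain ⟨rfl, hab⟩ := hab
        have := h3 a b hab
        rw [mHeight_cons]
        omega

theorem SSuf_cons (h : ℤ) (s : SStep) (p : List SStep) :
    SSuf h (s :: p) ↔ 0 ≤ h ∧ SSuf (h + s.height) p := by
  constructor
  · rintro ⟨h1, h2⟩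
    refine ⟨by simpa [sHeight_nil] using h1 [] (List.nil_prefix), ?_, ?_⟩
    · intro q hq
      have := h1 (s :: q) (by simpa using hq)
      rw [sHeight_cons] at this
      omega
    · rw [sHeight_cons] at h2
      omega
  · rintro ⟨h0, h1, h2⟩
    refine ⟨?_, ?_⟩
    · intro q hq
      rcases List.prefix_cons_iff.1 hq with rfl | ⟨t, rfl, ht⟩
      · simpa [sHeight_nil] using h0
      · have := h1 t ht
        rw [sHeight_cons]
        omega
    · rw [sHeight_cons]
      omega

theorem MSuf_neg {h : ℤ} (hh : h < 0) (p : List MStep) : ¬ MSuf h p := by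
  intro H
  have := H.1 [] (List.nil_prefix)
  rw [mHeight_nil] at this
  omega

theorem SSuf_neg {h : ℤ} (hh : h < 0) (p : List SStep) : ¬ SSuf h p := by
  intro H
  have := H.1 [] (List.nil_prefix)
  rw [sHeight_nil] at this
  omega

/-- Number of Motzkin suffixes. -/
noncomputable def mc (n : ℕ) (h : ℤ) : ℕ := {p : List MStep | p.length = n ∧ MSuf h p}.ncard

/-- Number of Schröder suffixes. -/
noncomputable def sc (w : ℕ) (h : ℤ) : ℕ := {p : List SStep | sWidth p = w ∧ SSuf h p}.ncard

theorem mc_neg (n : ℕ) {h : ℤ} (hh : h < 0) : mc n h = 0 := by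
  simp [mc, MSuf_neg hh]

theorem sc_neg (n : ℕ) {h : ℤ} (hh : h < 0) : sc n h = 0 := by
  simp [sc, SSuf_neg hh]

theorem mc_zero (h : ℤ) : mc 0 h = if h = 0 then 1 else 0 := by
  have : {p : List MStep | p.length = 0 ∧ MSuf h p} = if h = 0 then {[]} else ∅ := by
    ext p
    cases p with
    | nil => by_cases hh : h = 0 <;> simp [MSuf_nil, hh]
    | cons s p => by_cases hh : h = 0 <;> simp [hh]
  rw [mc, this]
  split_ifs <;> simp

theorem length_le_sWidth (p : List SStep) : p.length ≤ sWidth p := by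
  induction p with
  | nil => simp
  | cons s p ih =>
    rw [sWidth_cons, List.length_cons]
    cases s <;> simp [SStep.width] <;> omega

theorem sc_zero (h : ℤ) : sc 0 h = if h = 0 then 1 else 0 := by
  have : {p : List SStep | sWidth p = 0 ∧ SSuf h p} = if h = 0 then {[]} else ∅ := by
    ext p
    cases p with
    | nil => by_cases hh : h = 0 <;> simp [SSuf_nil, hh, sWidth]
    | cons s p =>
      have := length_le_sWidth (s :: p)
      rw [List.length_cons] at this
      have h2 : sWidth (s :: p) ≠ 0 := by omega
      by_cases hh : h = 0 <;> simp [hh, h2]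
  rw [sc, this]
  split_ifs <;> simp

theorem mc_succ (n : ℕ) {h : ℤ} (hh : 0 ≤ h) :
    mc (n + 1) h = mc n (h + 1) + 2 * mc n (h - 1) + 2 * mc n h
      + (if h = 0 then 0 else mc n h) := by
  rw [mc, ncard_by_head _ ((List.finite_length_eq MStep (n + 1)).subset fun p hp => hp.1)
    (by simp), sum_MStep]
  have h0 : (0 < h) ↔ h ≠ 0 := by omega
  by_cases hz : h = 0
  · simp [MSuf_cons, MStep.height, mc, hz]
    ring
  · simp [MSuf_cons, MStep.height, mc, hz, hh, h0, ← sub_eq_add_neg]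
    ring

theorem sc_succ (w : ℕ) {h : ℤ} (hh : 0 ≤ h) :
    sc (w + 1) h = sc w (h + 1) + sc w (h - 1) + (if w = 0 then 0 else sc (w - 1) h) := by
  rw [sc, ncard_by_head _ ((List.finite_length_le SStep (w + 1)).subset
    fun p hp => (length_le_sWidth p).trans hp.1.le) (by simp [sWidth]), sum_SStep]
  have e1 : ∀ p, 1 + sWidth p = w + 1 ↔ sWidth p = w := by intro p; omega
  by_cases hz : w = 0
  · have e2 : ∀ p, ¬ (2 + sWidth p = w + 1) := by intro p; omega
    simp only [Set.mem_ofPred_eq, SSuf_cons, sWidth_cons, SStep.height, SStep.width, sc, e1, e2, hh,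
      ← sub_eq_add_neg, hz, true_and, false_and, if_true]
    subst hz
    simp
    have e3 : ∀ p, ¬ (2 + sWidth p = 1) := by intro p; omega
    simp [e3]
  · have e2 : ∀ p, (2 + sWidth p = w + 1) ↔ sWidth p = w - 1 := by intro p; omega
    simp only [Set.mem_ofPred_eq, SSuf_cons, sWidth_cons, SStep.height, SStep.width, sc, e1, e2, hh,
      ← sub_eq_add_neg, hz, true_and, if_false, add_zero]
    ring

/-- Generating function of the large Schröder numbers, over the integers. -/
noncomputable def SG : PowerSeries ℤ := PowerSeries.mk fun n => (Nat.largeSchroder n : ℤ)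

theorem SG_eq : SG = 1 + X * SG + X * SG ^ 2 := by
  ext n
  cases n with
  | zero => simp [SG]
  | succ n =>
    rw [pow_two]
    rw [map_add, map_add, coeff_succ_X_mul, coeff_succ_X_mul, coeff_one, PowerSeries.coeff_mul]
    simp only [SG, coeff_mk, Nat.largeSchroder_succ]
    rw [Finset.Nat.sum_antidiagonal_eq_sum_range_succ
      (fun i j => (Nat.largeSchroder i : ℤ) * Nat.largeSchroder j)]
    have : Finset.Iic n = Finset.range (n + 1) := by ext; simp
    rw [this]
    push_cast
    simp

theorem SG_const : constantCoeff SG = 1 := by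
  rw [← coeff_zero_eq_constantCoeff_apply]; simp [SG]

theorem mc_eq (n : ℕ) : ∀ h : ℕ, (mc n h : ℤ) = coeff n ((SG - 1) ^ h * SG) := by
  induction n with
  | zero =>
    intro h
    rw [mc_zero]
    cases h with
    | zero => simp [SG_const]
    | succ h =>
      have : ((h + 1 : ℕ) : ℤ) ≠ 0 := by omega
      rw [if_neg this]
      simp [SG_const]
  | succ n ih =>
    intro h
    rw [mc_succ n (by omega)]
    cases h with
    | zero =>
      have e : (SG - 1) ^ 0 * SG = 1 + X * ((SG - 1) ^ 1 * SG + 2 • ((SG - 1) ^ 0 * SG)) := by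
        linear_combination SG_eq
      rw [e, map_add, coeff_succ_X_mul, map_add, map_nsmul, ← ih, ← ih]
      simp [coeff_one, mc_neg]
    | succ h =>
      have e : (SG - 1) ^ (h + 1) * SG = X * ((SG - 1) ^ (h + 2) * SG
          + 2 • ((SG - 1) ^ h * SG) + 3 • ((SG - 1) ^ (h + 1) * SG)) := by
        linear_combination (SG - 1) ^ h * SG * SG_eq
      rw [e, coeff_succ_X_mul, map_add, map_add, map_nsmul, map_nsmul, ← ih, ← ih, ← ih]
      have hz : ((h + 1 : ℕ) : ℤ) ≠ 0 := by omega
      rw [if_neg hz]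
      have e1 : ((h + 1 : ℕ) : ℤ) + 1 = ((h + 2 : ℕ) : ℤ) := by push_cast; ring
      have e2 : ((h + 1 : ℕ) : ℤ) - 1 = (h : ℤ) := by push_cast; ring
      rw [e1, e2]
      simp only [nsmul_eq_mul]
      push_cast
      ring

theorem sc_lt (w : ℕ) : ∀ h : ℤ, (w : ℤ) < h → sc w h = 0 := by
  induction w using Nat.strong_induction_on with
  | _ w ih =>
  intro h hw
  cases w with
  | zero => simp [sc_zero]; omega
  | succ w =>
    rw [sc_succ w (by omega), ih w (by omega) _ (by omega), ih w (by omega) _ (by omega)]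
    split_ifs with hz
    · rfl
    · rw [ih (w - 1) (by omega) _ (by omega)]

theorem sc_eq (w : ℕ) : ∀ h m : ℕ, w = h + 2 * m →
    (sc w h : ℤ) = coeff m (SG ^ (h + 1)) := by
  induction w using Nat.strong_induction_on with
  | _ w ih =>
  intro h m hw
  cases w with
  | zero =>
    obtain rfl : h = 0 := by omega
    obtain rfl : m = 0 := by omega
    simp [sc_zero, SG_const]
  | succ w =>
    rw [sc_succ w (by omega)]
    have e : SG ^ (h + 1) = SG ^ h + X * (SG ^ (h + 2) + SG ^ (h + 1)) := by
      linear_combination SG ^ h * SG_eq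
    have hD : (sc w ((h : ℤ) - 1) : ℤ) = coeff m (SG ^ h) := by
      cases h with
      | zero =>
        have : m ≠ 0 := by omega
        simp [sc_neg, coeff_one, this]
      | succ h =>
        rw [← ih w (by omega) h m (by omega)]
        simp
    rw [e, map_add, ← hD]
    cases m with
    | zero =>
      have hU : sc w ((h : ℤ) + 1) = 0 := by
        exact sc_lt _ _ (by omega)
      have hL : (if w = 0 then 0 else sc (w - 1) (h : ℤ)) = 0 := by
        split_ifs with hz
        · rfl
        · exact sc_lt _ _ (by omega)
      rw [hU, hL]
      simp
    | succ m =>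
      rw [coeff_succ_X_mul, map_add, if_neg (by omega),
        ← ih w (by omega) (h + 1) m (by omega), ← ih (w - 1) (by omega) h m (by omega)]
      push_cast
      ring

end Helpers

/-- The number of large (3,2)-Motzkin paths of length `n` equals the `n`-th
large Schröder number. -/
theorem large_motzkin32_eq_schroeder_large (n : ℕ) :
    L32 n = SchroederLarge n := by
  have h1 : L32 n = mc n 0 := by
    simp only [L32, mc, IsLargeMotzkin32, IsMotzkin32, MSuf, zero_add, and_assoc]
  have h2 : SchroederLarge n = sc (2 * n) 0 := by
    simp only [SchroederLarge, sc, IsLargeSchroeder, SSuf, zero_add]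
  have h3 := mc_eq n 0
  have h4 := sc_eq (2 * n) 0 n (by omega)
  rw [h1, h2]
  simp only [Nat.cast_zero, pow_zero, one_mul, zero_add, pow_one] at h3 h4
  exact_mod_cast h3.trans h4.symm
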